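/- Let a ≥ b ≥ 1 be integers. The Laplacian energy of the double star T(a+k, b-k) is a strictly decreasing function of k for k = 0, 1, …, b−1; that is, for all integers 0 ≤ k < k' ≤ b−1 one has LE(T(a+k, b-k)) > LE(T(a+k', b-k')). -/

import Mathlib

open Polynomial

namespace LapPaper

variable {V : Type} [Fintype V] [DecidableEq V]

/-- The multiset of Laplacian eigenvalues of `G` (with multiplicity), given as the
real roots of the characteristic polynomial of the Laplacian matrix `L = D - A`. -/
noncomputable def lapSpectrum (G : SimpleGraph V) [DecidableRel G.Adj] : Multiset ℝ :=
  (G.lapMatrix ℝ).charpoly.roots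

/-- The average degree `d̄ = 2|E|/n` of a graph. -/
noncomputable def avgDeg (G : SimpleGraph V) [DecidableRel G.Adj] : ℝ :=
  2 * G.edgeFinset.card / Fintype.card V

/-- The Laplacian energy `LE(G) = ∑_i |μ_i - d̄|`. -/
noncomputable def LE (G : SimpleGraph V) [DecidableRel G.Adj] : ℝ :=
  ((lapSpectrum G).map (fun x => |x - avgDeg G|)).sum

/-- `Sk G k` is the sum of the `k` largest Laplacian eigenvalues `μ_1 + ⋯ + μ_k` of `G`. -/
noncomputable def Sk (G : SimpleGraph V) [DecidableRel G.Adj] (k : ℕ) : ℝ :=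
  ((((lapSpectrum G).sort (· ≤ ·)).reverse).take k).sum

/-- The number `σ` of Laplacian eigenvalues of `G` strictly larger than the average degree. -/
noncomputable def sigma (G : SimpleGraph V) [DecidableRel G.Adj] : ℕ :=
  Multiset.card ((lapSpectrum G).filter (fun x => avgDeg G < x))

/-- The double star `T(a,b)` on `a + b + 2` vertices: vertex `0` is adjacent to vertex `1`
and to the `a` leaves `2, …, a+1`; vertex `1` is adjacent to the `b` leaves `a+2, …, a+b+1`. -/
def doubleStar (a b : ℕ) : SimpleGraph (Fin (a + b + 2)) :=
  SimpleGraph.fromRel (fun u v =>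
    (u.1 = 0 ∧ v.1 = 1) ∨ (u.1 = 0 ∧ 2 ≤ v.1 ∧ v.1 < a + 2) ∨ (u.1 = 1 ∧ a + 2 ≤ v.1))

noncomputable instance (a b : ℕ) : DecidableRel (doubleStar a b).Adj := Classical.decRel _

/-- The star on `n` vertices: vertex `0` is adjacent to all other vertices. -/
def starGraph (n : ℕ) : SimpleGraph (Fin n) :=
  SimpleGraph.fromRel (fun u _ => u.1 = 0)

noncomputable instance (n : ℕ) : DecidableRel (starGraph n).Adj := Classical.decRel _

end LapPaper

namespace LapPaper
open Matrix

/-- Vertices of the double star: the two centres, then the leaves at each of them. -/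
def doubleStarVertexEquiv (a b : ℕ) : Fin 2 ⊕ (Fin a ⊕ Fin b) ≃ Fin (a + b + 2) :=
  ((Equiv.refl _).sumCongr finSumFinEquiv).trans
    (finSumFinEquiv.trans (finCongr (Nat.add_comm 2 (a + b))))

/-- The Laplacian matrix of the double star in block form. -/
def doubleStarLap (a b : ℕ) : Matrix (Fin 2 ⊕ (Fin a ⊕ Fin b)) (Fin 2 ⊕ (Fin a ⊕ Fin b)) ℝ :=
  fromBlocks !![(a : ℝ) + 1, -1; -1, (b : ℝ) + 1]
    (of ![Sum.elim (fun _ => -1) (fun _ => 0), Sum.elim (fun _ => 0) (fun _ => -1)])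
    (of ![Sum.elim (fun _ => -1) (fun _ => 0), Sum.elim (fun _ => 0) (fun _ => -1)])ᵀ 1

@[simp] lemma doubleStarVertexEquiv_inl_val (a b : ℕ) (i : Fin 2) :
    (doubleStarVertexEquiv a b (.inl i)).val = i.val := rfl

@[simp] lemma doubleStarVertexEquiv_inr_inl_val (a b : ℕ) (i : Fin a) :
    (doubleStarVertexEquiv a b (.inr (.inl i))).val = 2 + i.val := rfl

@[simp] lemma doubleStarVertexEquiv_inr_inr_val (a b : ℕ) (i : Fin b) :
    (doubleStarVertexEquiv a b (.inr (.inr i))).val = 2 + (a + i.val) := rfl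

lemma doubleStar_adj_inl_inl (a b : ℕ) (i j : Fin 2) :
    (doubleStar a b).Adj (doubleStarVertexEquiv a b (.inl i)) (doubleStarVertexEquiv a b (.inl j)) ↔
      i ≠ j := by
  rw [doubleStar, SimpleGraph.fromRel_adj, Ne, Fin.ext_iff]
  simp only [doubleStarVertexEquiv_inl_val]
  omega

lemma doubleStar_adj_inl_inr_inl (a b : ℕ) (i : Fin 2) (j : Fin a) :
    (doubleStar a b).Adj (doubleStarVertexEquiv a b (.inl i))
      (doubleStarVertexEquiv a b (.inr (.inl j))) ↔ i = 0 := by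
  rw [doubleStar, SimpleGraph.fromRel_adj, Ne, Fin.ext_iff]
  simp only [doubleStarVertexEquiv_inl_val, doubleStarVertexEquiv_inr_inl_val]
  omega

lemma doubleStar_adj_inl_inr_inr (a b : ℕ) (i : Fin 2) (j : Fin b) :
    (doubleStar a b).Adj (doubleStarVertexEquiv a b (.inl i))
      (doubleStarVertexEquiv a b (.inr (.inr j))) ↔ i = 1 := by
  rw [doubleStar, SimpleGraph.fromRel_adj, Ne, Fin.ext_iff]
  simp only [doubleStarVertexEquiv_inl_val, doubleStarVertexEquiv_inr_inr_val]
  omega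

lemma doubleStar_not_adj_inr_inr (a b : ℕ) (i j : Fin a ⊕ Fin b) :
    ¬ (doubleStar a b).Adj (doubleStarVertexEquiv a b (.inr i))
      (doubleStarVertexEquiv a b (.inr j)) := by
  rw [doubleStar, SimpleGraph.fromRel_adj, Ne, Fin.ext_iff]
  rcases i with i | i <;> rcases j with j | j <;>
    simp only [doubleStarVertexEquiv_inr_inl_val, doubleStarVertexEquiv_inr_inr_val] <;> omega

lemma doubleStar_degree (a b : ℕ) (v : Fin 2 ⊕ (Fin a ⊕ Fin b)) :
    (doubleStar a b).degree (doubleStarVertexEquiv a b v) =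
      Sum.elim ![a + 1, b + 1] (fun _ => 1) v := by
  rw [← SimpleGraph.card_neighborFinset_eq_degree, SimpleGraph.neighborFinset_eq_filter,
    Finset.card_filter, ← (doubleStarVertexEquiv a b).sum_comp, Fintype.sum_sum_type,
    Fintype.sum_sum_type]
  rcases v with v | v | v
  · fin_cases v <;>
    simp [-Finset.sum_boole, doubleStar_adj_inl_inl, doubleStar_adj_inl_inr_inl,
      doubleStar_adj_inl_inr_inr, add_comm]
  · simp [-Finset.sum_boole, (doubleStar a b).adj_comm (doubleStarVertexEquiv a b (.inr _))
      (doubleStarVertexEquiv a b (.inl _)), doubleStar_adj_inl_inr_inl, doubleStar_not_adj_inr_inr]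
  · simp [-Finset.sum_boole, (doubleStar a b).adj_comm (doubleStarVertexEquiv a b (.inr _))
      (doubleStarVertexEquiv a b (.inl _)), doubleStar_adj_inl_inr_inr, doubleStar_not_adj_inr_inr]

lemma doubleStar_lapMatrix_submatrix (a b : ℕ) :
    ((doubleStar a b).lapMatrix ℝ).submatrix (doubleStarVertexEquiv a b)
      (doubleStarVertexEquiv a b) = doubleStarLap a b := by
  ext i j
  simp only [submatrix_apply, SimpleGraph.lapMatrix, Matrix.sub_apply, SimpleGraph.degMatrix,
    diagonal_apply, doubleStar_degree, EmbeddingLike.apply_eq_iff_eq, SimpleGraph.adjMatrix_apply]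
  rcases i with i | i
  · rcases j with j | j | j
    · fin_cases i <;> fin_cases j <;> simp [doubleStarLap, doubleStar_adj_inl_inl]
    · fin_cases i <;> simp [doubleStarLap, doubleStar_adj_inl_inr_inl]
    · fin_cases i <;> simp [doubleStarLap, doubleStar_adj_inl_inr_inr]
  · rcases j with j | j
    · simp only [(doubleStar a b).adj_comm (doubleStarVertexEquiv a b (.inr i))]
      rcases i with i | i <;> fin_cases j <;>
        simp [doubleStarLap, doubleStar_adj_inl_inr_inl, doubleStar_adj_inl_inr_inr]
    · simp [doubleStarLap, doubleStar_not_adj_inr_inr, one_apply]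

lemma det_fromBlocks_smul_one {R m n : Type*} [CommRing R] [Fintype m] [DecidableEq m]
    [Fintype n] [DecidableEq n] (A : Matrix m m R) (B : Matrix m n R) (C : Matrix n m R) (d : R) :
    (fromBlocks A B C (d • 1)).det * d ^ Fintype.card m =
      (d • A - B * C).det * d ^ Fintype.card n := by
  have h : fromBlocks A B C (d • 1) * fromBlocks (d • 1) 0 (-C) 1 =
      fromBlocks (d • A - B * C) B 0 (d • 1) := by
    simp [fromBlocks_multiply, sub_eq_add_neg]
  simpa [det_smul] using congrArg det h

/-- The cubic factor of the Laplacian characteristic polynomial of `T(a, b)`, in terms of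
`s = a + b` and `p = a * b`. -/
noncomputable def doubleStarCubic (s p : ℝ) : ℝ[X] := (X - 1) ^ 2 * (X - (C s + 2)) + C p * X

lemma doubleStar_charpoly (a b : ℕ) (ha : 1 ≤ a) (hb : 1 ≤ b) :
    ((doubleStar a b).lapMatrix ℝ).charpoly =
      (X - C 1) ^ (a + b - 2) * ((X - C 0) * doubleStarCubic (a + b) (a * b)) := by
  rw [← charpoly_reindex (doubleStarVertexEquiv a b).symm, reindex_apply, Equiv.symm_symm,
    doubleStar_lapMatrix_submatrix, doubleStarLap, charpoly, charmatrix_fromBlocks]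
  have h1 : (charmatrix (1 : Matrix (Fin a ⊕ Fin b) (Fin a ⊕ Fin b) ℝ)) =
      (X - 1 : ℝ[X]) • 1 := by
    ext1 i j
    simp [charmatrix_apply, diagonal_apply, one_apply]
    split_ifs <;> simp
  have hne : (X - 1 : ℝ[X]) ^ 2 ≠ 0 := pow_ne_zero _ (by simpa using X_sub_C_ne_zero (1 : ℝ))
  apply mul_right_cancel₀ hne
  have := det_fromBlocks_smul_one (charmatrix !![(a : ℝ) + 1, -1; -1, (b : ℝ) + 1])
    (-(of ![Sum.elim (fun _ => -1) (fun _ => 0), Sum.elim (fun _ => 0) (fun _ => -1)] :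
      Matrix (Fin 2) (Fin a ⊕ Fin b) ℝ).map C)
    (-((of ![Sum.elim (fun _ => -1) (fun _ => 0), Sum.elim (fun _ => 0) (fun _ => -1)] :
      Matrix (Fin 2) (Fin a ⊕ Fin b) ℝ)ᵀ).map C) (X - 1 : ℝ[X])
  rw [Fintype.card_fin] at this
  rw [h1, this, det_fin_two]
  obtain ⟨m, hm⟩ : ∃ m, a + b = m + 2 := ⟨a + b - 2, by omega⟩
  simp [mul_apply, Fintype.sum_sum_type, hm, doubleStarCubic]
  ring

lemma doubleStar_avgDeg (a b : ℕ) :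
    avgDeg (doubleStar a b) = 2 * (a + b + 1) / (a + b + 2) := by
  have h : 2 * (doubleStar a b).edgeFinset.card = 2 * (a + b + 1) := by
    rw [← SimpleGraph.sum_degrees_eq_twice_card_edges, ← (doubleStarVertexEquiv a b).sum_comp]
    simp [doubleStar_degree, Fintype.sum_sum_type]
    ring
  have h' : (2 * (doubleStar a b).edgeFinset.card : ℝ) = 2 * (a + b + 1) := by exact_mod_cast h
  rw [avgDeg, h']
  simp

lemma eval_doubleStarCubic (s p x : ℝ) :
    (doubleStarCubic s p).eval x = (x - 1) ^ 2 * (x - (s + 2)) + p * x := by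
  simp [doubleStarCubic]

lemma doubleStarCubic_eq_toPoly (s p : ℝ) :
    doubleStarCubic s p = Cubic.toPoly ⟨1, -(s + 4), 2 * s + 5 + p, -(s + 2)⟩ := by
  simp [doubleStarCubic, Cubic.toPoly, map_ofNat C]
  ring

lemma monic_doubleStarCubic (s p : ℝ) : (doubleStarCubic s p).Monic := by
  rw [doubleStarCubic_eq_toPoly]
  exact Cubic.monic_of_a_eq_one rfl

lemma natDegree_doubleStarCubic (s p : ℝ) : (doubleStarCubic s p).natDegree = 3 := by
  rw [doubleStarCubic_eq_toPoly]
  exact Cubic.natDegree_of_a_ne_zero one_ne_zero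

lemma splits_doubleStarCubic (a b : ℕ) (ha : 1 ≤ a) (hb : 1 ≤ b) :
    (doubleStarCubic (a + b) (a * b)).Splits := by
  have h : ((doubleStar a b).lapMatrix ℝ).charpoly.Splits :=
    ((doubleStar a b).isHermitian_lapMatrix ℝ).splits_charpoly
  have hne := (charpoly_monic ((doubleStar a b).lapMatrix ℝ)).ne_zero
  refine h.of_dvd hne ?_
  rw [doubleStar_charpoly a b ha hb]
  exact (dvd_mul_left _ _).mul_left _

lemma exists_root_doubleStarCubic {s p : ℝ} (hs : 0 ≤ s) (hp : 0 < p) :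
    ∃ r ∈ Set.Ioo (0 : ℝ) 1, (doubleStarCubic s p).eval r = 0 := by
  have h := intermediate_value_Ioo (zero_le_one' ℝ) (doubleStarCubic s p).continuousOn
  exact h ⟨by rw [eval_doubleStarCubic]; linarith, by rw [eval_doubleStarCubic]; linarith⟩

lemma doubleStar_lapSpectrum (a b : ℕ) (ha : 1 ≤ a) (hb : 1 ≤ b) :
    lapSpectrum (doubleStar a b) = Multiset.replicate (a + b - 2) 1 +
      ({0} + (doubleStarCubic (a + b) (a * b)).roots) := by
  have hc := (monic_doubleStarCubic ((a : ℝ) + b) (a * b)).ne_zero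
  have h0 := X_sub_C_ne_zero (0 : ℝ)
  have h1 := pow_ne_zero (a + b - 2) (X_sub_C_ne_zero (1 : ℝ))
  rw [lapSpectrum, doubleStar_charpoly a b ha hb, roots_mul (mul_ne_zero h1 (mul_ne_zero h0 hc)),
    roots_mul (mul_ne_zero h0 hc), roots_pow, roots_X_sub_C, roots_X_sub_C,
    Multiset.nsmul_singleton]

lemma doubleStarCubic_eval_avgDeg_pos {s p : ℝ} (hs : 2 ≤ s) (hp : s - 1 ≤ p) :
    0 < (doubleStarCubic s p).eval (2 * (s + 1) / (s + 2)) := by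
  have hs2 : 0 < s + 2 := by linarith
  have h : (doubleStarCubic s p).eval (2 * (s + 1) / (s + 2)) =
      (2 * p * (s + 1) * (s + 2) ^ 2 - s ^ 2 * ((s + 2) ^ 2 - 2 * (s + 1))) / (s + 2) ^ 3 := by
    rw [eval_doubleStarCubic]
    field_simp
    ring
  rw [h]
  apply div_pos _ (by positivity)
  obtain ⟨t, rfl⟩ : ∃ t, s = t + 2 := ⟨s - 2, by ring⟩
  obtain ⟨q, rfl⟩ : ∃ q, p = q + (t + 2 - 1) := ⟨p - (t + 2 - 1), by ring⟩
  have ht : 0 ≤ t := by linarith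
  have hq : 0 ≤ q := by linarith
  ring_nf
  positivity

/-- The Laplacian energy of `T(a, b)` in terms of its algebraic connectivity `r`. -/
lemma doubleStar_LE_eq (a b : ℕ) (ha : 1 ≤ a) (hb : 1 ≤ b) {r : ℝ} (hr1 : r < 1)
    (hr : (doubleStarCubic (a + b) (a * b)).eval r = 0) :
    LE (doubleStar a b) =
      (a + b - 2) * (2 * (a + b + 1) / (a + b + 2) - 1) + (a + b + 4) - 2 * r := by
  have ha' : (1 : ℝ) ≤ a := by exact_mod_cast ha
  have hb' : (1 : ℝ) ≤ b := by exact_mod_cast hb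
  have hcast : ((a + b - 2 : ℕ) : ℝ) = a + b - 2 := by
    rw [Nat.cast_sub (by omega)]
    push_cast
    ring
  rw [LE, doubleStar_lapSpectrum a b ha hb, doubleStar_avgDeg]
  have hs : (doubleStarCubic (a + b) (a * b)).Splits := splits_doubleStarCubic a b ha hb
  have hpos := doubleStarCubic_eval_avgDeg_pos (s := a + b) (p := a * b) (by linarith)
    (by nlinarith)
  have hd1 : 1 ≤ 2 * ((a : ℝ) + b + 1) / (a + b + 2) := by
    rw [le_div_iff₀ (by positivity)]
    linarith
  have hd2 : 2 * ((a : ℝ) + b + 1) / (a + b + 2) < 2 := by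
    rw [div_lt_iff₀ (by positivity)]
    linarith
  generalize 2 * ((a : ℝ) + b + 1) / (a + b + 2) = d at *
  have hm := monic_doubleStarCubic ((a : ℝ) + b) (a * b)
  obtain ⟨t, ht⟩ := Multiset.exists_cons_of_mem ((mem_roots hm.ne_zero).2 hr)
  have hcard := splits_iff_card_roots.1 hs
  rw [natDegree_doubleStarCubic, ht, Multiset.card_cons] at hcard
  obtain ⟨y, z, rfl⟩ := Multiset.card_eq_two.1 (Nat.succ_injective hcard)
  have hev (x : ℝ) : (x - 1) ^ 2 * (x - (a + b + 2)) + a * b * x =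
      (x - r) * ((x - y) * (x - z)) := by
    rw [← eval_doubleStarCubic, hs.eval_eq_prod_roots, hm.leadingCoeff, ht]
    simp
  have hsum : y + z = a + b + 4 - r := by linarith [hev 0, hev 1, hev (-1)]
  rw [eval_doubleStarCubic, hev] at hpos
  have hyz : 0 < (d - y) * (d - z) := pos_of_mul_pos_right hpos (by linarith)
  have hy : d < y ∧ d < z := by
    rcases pos_and_pos_or_neg_and_neg_of_mul_pos hyz with h | h
    · linarith
    · constructor <;> linarith
  rw [ht]
  simp only [Multiset.map_add, Multiset.sum_add, Multiset.map_replicate, Multiset.sum_replicate,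
    Multiset.map_singleton, Multiset.sum_singleton, Multiset.map_cons, Multiset.sum_cons,
    Multiset.insert_eq_cons, nsmul_eq_mul, hcast]
  rw [abs_of_nonpos (by linarith : 1 - d ≤ 0), abs_of_nonpos (by linarith : 0 - d ≤ 0),
    abs_of_nonpos (by linarith : r - d ≤ 0), abs_of_pos (by linarith : 0 < y - d),
    abs_of_pos (by linarith : 0 < z - d)]
  linarith

lemma doubleStarCubic_root_lt {s p p' r r' : ℝ} (hs : 0 ≤ s) (hp' : 0 < p') (hpp' : p' < p)
    (hr0 : 0 < r) (hr1 : r < 1) (hr : (doubleStarCubic s p).eval r = 0)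
    (hr' : (doubleStarCubic s p').eval r' = 0) : r < r' := by
  by_contra! h
  rw [eval_doubleStarCubic] at hr hr'
  have h1 : (1 - r) ^ 2 * (s + 2 - r) ≤ (1 - r') ^ 2 * (s + 2 - r') := by
    have : 0 ≤ 1 - r := by linarith
    have : 0 ≤ s + 2 - r := by linarith
    gcongr
  have h2 : p' * r' ≤ p' * r := by gcongr
  have h3 : p' * r < p * r := by gcongr
  linarith

/-- For integers `a ≥ b ≥ 1`, the Laplacian energy of the double star
`T(a+k, b-k)` is a strictly decreasing function of `k` for `k = 0, 1, …, b-1`. -/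
theorem doubleStar_LE_strictAnti (a b : ℕ) (hab : b ≤ a) (hb : 1 ≤ b)
    (k k' : ℕ) (hkk' : k < k') (hk' : k' ≤ b - 1) :
    LE (doubleStar (a + k) (b - k)) > LE (doubleStar (a + k') (b - k')) := by
  obtain ⟨m, hm⟩ : ∃ m, b - k' = m + 1 := ⟨b - k' - 1, by omega⟩
  obtain ⟨j, hj⟩ : ∃ j, k' = k + j + 1 := ⟨k' - k - 1, by omega⟩
  have hbk : b - k = m + 1 + (j + 1) := by omega
  have hak : ∃ i, a + k = m + 1 + (j + 1) + i := ⟨a + k - (m + 1 + (j + 1)), by omega⟩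
  obtain ⟨i, hi⟩ := hak
  have hak' : a + k' = m + 1 + (j + 1) + i + (j + 1) := by omega
  rw [hm, hbk, hi, hak']
  set u := m + 1 + (j + 1) + i with hu
  set v := m + 1 with hv
  set w := j + 1 with hw
  have hsum : (((u + w : ℕ) : ℝ) + (v : ℕ)) = (u : ℕ) + ((v + w : ℕ) : ℝ) := by
    push_cast
    ring
  have hu0 : 0 < u := by omega
  have hv0 : 0 < v := by omega
  have hw0 : 0 < w := by omega
  have hprod : (((u + w : ℕ) : ℝ) * (v : ℕ)) < (u : ℕ) * ((v + w : ℕ) : ℝ) := by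
    norm_cast
    have : v < u := by omega
    nlinarith
  obtain ⟨r, ⟨hr0, hr1⟩, hr⟩ := exists_root_doubleStarCubic
    (s := (u : ℕ) + ((v + w : ℕ) : ℝ)) (p := (u : ℕ) * ((v + w : ℕ) : ℝ))
    (by positivity) (by positivity)
  obtain ⟨r', ⟨hr0', hr1'⟩, hr'⟩ := exists_root_doubleStarCubic
    (s := ((u + w : ℕ) : ℝ) + (v : ℕ)) (p := ((u + w : ℕ) : ℝ) * (v : ℕ))
    (by positivity) (by positivity)
  rw [doubleStar_LE_eq _ _ (by omega) (by omega) hr1 hr,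
    doubleStar_LE_eq _ _ (by omega) (by omega) hr1' hr', hsum]
  rw [hsum] at hr'
  have := doubleStarCubic_root_lt (by positivity) (by positivity) hprod hr0 hr1 hr hr'
  linarith

end LapPaper
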